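/- Let p,q ∈ (1,∞) and let v,w be weights on ℝⁿ such that Mv ≤ [v,w]_{A_1}·w almost everywhere and Mw ≤ [w]_{A_1}·w almost everywhere (with both constants finite). Then the operator Tf := M(fv)/w satisfies ‖T‖_{L^{p',q'}(v)→L^{p',q'}(w)} ≤ C_n p^{1/min(p',q')} (log(e+[v,w]_{A_1}))^{1/min(p',q')} (1+[v,w]_{A_1}) [w]_{A_1}^{1/p'}, where C_n depends only on n, p'=p/(p-1) and q'=q/(q-1). -/

import Mathlib

open MeasureTheory ENNReal NNReal Set

noncomputable section

/-- The conjugate exponent `p' = p/(p-1)`. -/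
def conjExp (p : ℝ) : ℝ := p / (p - 1)
/-- An (open) axis-parallel cube in `ℝⁿ`. -/
def IsCube (n : ℕ) (Q : Set (Fin n → ℝ)) : Prop :=
  ∃ (a : Fin n → ℝ) (r : ℝ), 0 < r ∧ Q = Set.univ.pi fun i => Set.Ioo (a i) (a i + r)

/-- An (open) axis-parallel rectangle in `ℝⁿ`. -/
def IsRect (n : ℕ) (R : Set (Fin n → ℝ)) : Prop :=
  ∃ a b : Fin n → ℝ, (∀ i, a i < b i) ∧ R = Set.univ.pi fun i => Set.Ioo (a i) (b i)

/-- The average `⨍_Q f` of a nonnegative function over a set. -/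
def setAvg {n : ℕ} (Q : Set (Fin n → ℝ)) (f : (Fin n → ℝ) → ℝ≥0∞) : ℝ≥0∞ :=
  (∫⁻ x in Q, f x) / volume Q

/-- The Hardy–Littlewood maximal operator (over axis-parallel cubes). -/
def maximal {n : ℕ} (f : (Fin n → ℝ) → ℝ≥0∞) (x : Fin n → ℝ) : ℝ≥0∞ :=
  ⨆ (Q : Set (Fin n → ℝ)) (_ : IsCube n Q) (_ : x ∈ Q), setAvg Q f

/-- The strong maximal operator (over axis-parallel rectangles). -/
def maximalR {n : ℕ} (f : (Fin n → ℝ) → ℝ≥0∞) (x : Fin n → ℝ) : ℝ≥0∞ :=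
  ⨆ (R : Set (Fin n → ℝ)) (_ : IsRect n R) (_ : x ∈ R), setAvg R f

/-- The dual weight `σ = w^{1-p'}`. -/
def dualWeight {n : ℕ} (p : ℝ) (w : (Fin n → ℝ) → ℝ≥0∞) : (Fin n → ℝ) → ℝ≥0∞ :=
  fun x => w x ^ (1 - conjExp p)

/-- The two-weight Muckenhoupt constant `[v,w]_{A_p}`. -/
def twoApConst (n : ℕ) (p : ℝ) (v w : (Fin n → ℝ) → ℝ≥0∞) : ℝ≥0∞ :=
  ⨆ (Q : Set (Fin n → ℝ)) (_ : IsCube n Q),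
    setAvg Q v * setAvg Q (dualWeight p w) ^ (p - 1)

/-- The Muckenhoupt constant `[w]_{A_p}`. -/
def ApConst (n : ℕ) (p : ℝ) (w : (Fin n → ℝ) → ℝ≥0∞) : ℝ≥0∞ := twoApConst n p w w

/-- The Fujii–Wilson constant `[w]_{A_∞}`. -/
def AinfConst (n : ℕ) (w : (Fin n → ℝ) → ℝ≥0∞) : ℝ≥0∞ :=
  ⨆ (Q : Set (Fin n → ℝ)) (_ : IsCube n Q),
    (∫⁻ x in Q, maximal (Q.indicator w) x) / ∫⁻ x in Q, w x

/-- The strong Muckenhoupt constant `[w]_{A_{p,ℛ}}`. -/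
def ApRConst (n : ℕ) (p : ℝ) (w : (Fin n → ℝ) → ℝ≥0∞) : ℝ≥0∞ :=
  ⨆ (R : Set (Fin n → ℝ)) (_ : IsRect n R),
    setAvg R w * setAvg R (dualWeight p w) ^ (p - 1)

/-- The strong Fujii–Wilson constant `[w]_{A_{∞,ℛ}}`. -/
def AinfRConst (n : ℕ) (w : (Fin n → ℝ) → ℝ≥0∞) : ℝ≥0∞ :=
  ⨆ (R : Set (Fin n → ℝ)) (_ : IsRect n R),
    (∫⁻ x in R, maximalR (R.indicator w) x) / ∫⁻ x in R, w x
/-- The weighted distribution function `w({|f| > s})`. -/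
def wDist {α : Type*} [MeasurableSpace α] (μ : Measure α) (w : α → ℝ≥0∞)
    (f : α → ℝ≥0∞) (s : ℝ) : ℝ≥0∞ :=
  ∫⁻ x in {x | ENNReal.ofReal s < f x}, w x ∂μ

/-- The weighted Lorentz quasinorm `‖f‖_{L^{p,q}(w)}`; for `q = ∞` it is the weak norm. -/
def lorentzNorm {α : Type*} [MeasurableSpace α] (μ : Measure α) (w : α → ℝ≥0∞)
    (p : ℝ) (q : ℝ≥0∞) (f : α → ℝ≥0∞) : ℝ≥0∞ :=
  if q = ∞ then ⨆ (s : ℝ) (_ : 0 < s), ENNReal.ofReal s * wDist μ w f s ^ (1 / p)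
  else (ENNReal.ofReal p * ∫⁻ s in Set.Ioi (0 : ℝ),
      ENNReal.ofReal s ^ q.toReal * wDist μ w f s ^ (q.toReal / p) / ENNReal.ofReal s) ^ (1 / q.toReal)

/-- `min(p,q)` for a real `p` and an extended-real `q`. -/
def minE (p : ℝ) (q : ℝ≥0∞) : ℝ := if q = ∞ then p else min p q.toReal
lemma isCube_ball {n : ℕ} (c : Fin n → ℝ) {r : ℝ} (hr : 0 < r) : IsCube n (Metric.ball c r) := by
  refine ⟨fun i => c i - r, 2 * r, by linarith, ?_⟩
  rw [ball_pi c hr]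
  congr 1
  ext i x
  rw [Real.ball_eq_Ioo]
  constructor <;> rintro ⟨h1, h2⟩ <;> constructor <;> linarith

lemma cube_eq_ball {n : ℕ} {Q : Set (Fin n → ℝ)} (hQ : IsCube n Q) :
    ∃ (c : Fin n → ℝ) (r : ℝ), 0 < r ∧ Q = Metric.ball c r := by
  obtain ⟨a, r, hr, rfl⟩ := hQ
  refine ⟨fun i => a i + r / 2, r / 2, by linarith, ?_⟩
  rw [ball_pi _ (by linarith)]
  congr 1
  ext i x
  rw [Real.ball_eq_Ioo]
  constructor <;> rintro ⟨h1, h2⟩ <;> constructor <;> linarith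

lemma vol_six {n : ℕ} (c : Fin n → ℝ) {r : ℝ} (hr : 0 < r) :
    volume (Metric.ball c (6 * r)) = 6 ^ n * volume (Metric.ball c r) := by
  rw [Real.volume_pi_ball _ (by linarith), Real.volume_pi_ball _ hr]
  have h6 : (6 : ℝ≥0∞) = ENNReal.ofReal 6 := by simp
  rw [h6, ← ENNReal.ofReal_pow (by norm_num), ← ENNReal.ofReal_mul (by positivity)]
  congr 1
  simp only [Fintype.card_fin]
  rw [← mul_pow]
  congr 1
  ring

lemma vol_ball_ne_zero {n : ℕ} (c : Fin n → ℝ) {r : ℝ} (hr : 0 < r) :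
    volume (Metric.ball c r) ≠ 0 := (Metric.measure_ball_pos _ _ hr).ne'

lemma vol_ball_ne_top {n : ℕ} (c : Fin n → ℝ) (r : ℝ) :
    volume (Metric.ball c r) ≠ ∞ := measure_ball_lt_top.ne

lemma int_ball_le {n : ℕ} (w : (Fin n → ℝ) → ℝ≥0∞) (c : Fin n → ℝ) {r : ℝ} (hr : 0 < r)
    {x : Fin n → ℝ} (hx : x ∈ Metric.ball c r) :
    ∫⁻ y in Metric.ball c r, w y ≤ maximal w x * volume (Metric.ball c r) := by
  rw [← ENNReal.div_le_iff (vol_ball_ne_zero c hr) (vol_ball_ne_top c r)]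
  unfold maximal
  exact le_iSup₂_of_le (Metric.ball c r) (isCube_ball c hr) (le_iSup_of_le hx le_rfl)

lemma weak_bounded {n : ℕ} (w g : (Fin n → ℝ) → ℝ≥0∞) (K s : ℝ≥0∞)
    (R : ℝ) (S : Set (Fin n → ℝ))
    (hS : ∀ x ∈ S, maximal w x ≤ K * w x ∧ ∃ (c : Fin n → ℝ) (r : ℝ), 0 < r ∧ r ≤ R ∧
      x ∈ Metric.ball c r ∧ s * w x * volume (Metric.ball c r) ≤ ∫⁻ y in Metric.ball c r, g y) :
    s * (volume.withDensity w) S ≤ K * 6 ^ n * ∫⁻ y, g y := by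
  choose! hK c r hr hR hx hg using hS
  obtain ⟨u, huS, hdis, hcov⟩ := Vitali.exists_disjoint_subfamily_covering_enlargement_closedBall
    S c r R hR 5 (by norm_num)
  have hdis' : u.PairwiseDisjoint fun a => Metric.ball (c a) (r a) :=
    hdis.mono fun a => Metric.ball_subset_closedBall
  have hcount : u.Countable := hdis'.countable_of_isOpen (fun _ _ => Metric.isOpen_ball)
    (fun a ha => ⟨a, hx a (huS ha)⟩)
  have hsub : S ⊆ ⋃ a ∈ u, Metric.ball (c a) (6 * r a) := by
    intro x hxS
    obtain ⟨b, hb, hsubb⟩ := hcov x hxS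
    refine mem_iUnion₂.2 ⟨b, hb, ?_⟩
    have := hsubb (Metric.ball_subset_closedBall (hx x hxS))
    refine Metric.closedBall_subset_ball ?_ this
    have := hr b (huS hb)
    linarith
  have key : ∀ a ∈ u, s * (volume.withDensity w) (Metric.ball (c a) (6 * r a)) ≤
      K * 6 ^ n * ∫⁻ y in Metric.ball (c a) (r a), g y := by
    intro a ha
    have haS := huS ha
    have hra := hr a haS
    rw [withDensity_apply _ Metric.isOpen_ball.measurableSet]
    calc s * ∫⁻ y in Metric.ball (c a) (6 * r a), w y
        ≤ s * (maximal w a * volume (Metric.ball (c a) (6 * r a))) := by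
          gcongr
          exact int_ball_le w (c a) (by linarith)
            (Metric.ball_subset_ball (by linarith) (hx a haS))
      _ ≤ s * (K * w a * (6 ^ n * volume (Metric.ball (c a) (r a)))) := by
          rw [vol_six _ hra]
          gcongr
          exact hK a haS
      _ = K * 6 ^ n * (s * w a * volume (Metric.ball (c a) (r a))) := by ring
      _ ≤ _ := by
          gcongr
          exact hg a haS
  calc s * (volume.withDensity w) S
      ≤ s * ∑' a : u, (volume.withDensity w) (Metric.ball (c a) (6 * r a)) := by
        gcongr
        exact (measure_mono hsub).trans (measure_biUnion_le _ hcount _)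
    _ = ∑' a : u, s * (volume.withDensity w) (Metric.ball (c a) (6 * r a)) :=
        ENNReal.tsum_mul_left.symm
    _ ≤ ∑' a : u, K * 6 ^ n * ∫⁻ y in Metric.ball (c a) (r a), g y :=
        ENNReal.tsum_le_tsum fun a => key a a.2
    _ = K * 6 ^ n * ∑' a : u, ∫⁻ y in Metric.ball (c a) (r a), g y := ENNReal.tsum_mul_left
    _ = K * 6 ^ n * ∫⁻ y in ⋃ a ∈ u, Metric.ball (c a) (r a), g y := by
        rw [lintegral_biUnion hcount (fun _ _ => Metric.isOpen_ball.measurableSet) hdis']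
    _ ≤ _ := by
        gcongr
        exact Measure.restrict_le_self

lemma weak11 {n : ℕ} (w g : (Fin n → ℝ) → ℝ≥0∞) (K s : ℝ≥0∞)
    (hw : ∀ᵐ x ∂(volume : Measure (Fin n → ℝ)), maximal w x ≤ K * w x) :
    s * (volume.withDensity w) {x | s * w x < maximal g x} ≤ K * 6 ^ n * ∫⁻ y, g y := by
  let S : ℕ → Set (Fin n → ℝ) := fun N => {x | maximal w x ≤ K * w x ∧
    ∃ (c : Fin n → ℝ) (r : ℝ), 0 < r ∧ r ≤ N ∧
      x ∈ Metric.ball c r ∧ s * w x * volume (Metric.ball c r) ≤ ∫⁻ y in Metric.ball c r, g y}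
  have hmono : Monotone S := by
    rintro N N' hN x ⟨h1, c, r, hr, hrN, h⟩
    exact ⟨h1, c, r, hr, hrN.trans (by exact_mod_cast hN), h⟩
  have hle : (volume.withDensity w) {x | s * w x < maximal g x} ≤
      (volume.withDensity w) (⋃ N, S N) := by
    apply measure_mono_ae
    filter_upwards [(withDensity_absolutelyContinuous volume w).ae_le hw] with x hx hlt
    have hlt' : s * w x < maximal g x := hlt
    unfold maximal at hlt'
    simp only [lt_iSup_iff] at hlt'
    obtain ⟨Q, hQ, hxQ, hlt⟩ := hlt'
    obtain ⟨c, r, hr, rfl⟩ := cube_eq_ball hQ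
    obtain ⟨N, hN⟩ := exists_nat_ge r
    exact mem_iUnion.2 ⟨N, hx, c, r, hr, hN, hxQ, (ENNReal.mul_lt_of_lt_div hlt).le⟩
  refine (mul_le_mul_right hle s).trans ?_
  rw [hmono.measure_iUnion, ENNReal.mul_iSup]
  exact iSup_le fun N => weak_bounded w g K s N (S N) fun x hx => hx

lemma maximal_mono_add {n : ℕ} (g g1 v : (Fin n → ℝ) → ℝ≥0∞) (hg1 : Measurable g1) (a : ℝ≥0∞)
    (hv : Measurable v)
    (h : ∀ x, g x ≤ g1 x + a * v x) (x : Fin n → ℝ) :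
    maximal g x ≤ maximal g1 x + a * maximal v x := by
  unfold maximal
  refine iSup_le fun Q => iSup_le fun hQ => iSup_le fun hx => ?_
  have h1 : setAvg Q g ≤ setAvg Q g1 + a * setAvg Q v := by
    unfold setAvg
    rw [← mul_div_assoc, ← ENNReal.add_div, ← lintegral_const_mul _ hv, ← lintegral_add_left hg1]
    gcongr with x
    exact h x
  refine h1.trans ?_
  gcongr
  · exact le_iSup₂_of_le Q hQ (le_iSup_of_le hx le_rfl)
  · exact le_iSup₂_of_le Q hQ (le_iSup_of_le hx le_rfl)

/-- Distributional estimate. -/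
lemma dist_bound {n : ℕ} (v w f : (Fin n → ℝ) → ℝ≥0∞) (hv : Measurable v)
    (hf : Measurable f) (A B : ℝ) (hA : 0 < A) 
    (hvw : ∀ᵐ x ∂(volume : Measure (Fin n → ℝ)), maximal v x ≤ ENNReal.ofReal A * w x)
    (hw : ∀ᵐ x ∂(volume : Measure (Fin n → ℝ)), maximal w x ≤ ENNReal.ofReal B * w x)
    (s : ℝ) (hs : 0 < s) :
    ENNReal.ofReal s * wDist volume w (fun x => maximal (fun y => f y * v y) x / w x) s ≤
      2 * 6 ^ n * ENNReal.ofReal B *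
        ∫⁻ y in {y | ENNReal.ofReal (s / (2 * A)) < f y}, f y * v y := by
  have hmeas : MeasurableSet {y | ENNReal.ofReal (s / (2 * A)) < f y} :=
    measurableSet_lt measurable_const hf
  set g1 : (Fin n → ℝ) → ℝ≥0∞ :=
    {y | ENNReal.ofReal (s / (2 * A)) < f y}.indicator (fun y => f y * v y) with hg1
  have hg1m : Measurable g1 := (hf.mul hv).indicator hmeas
  have hpt : ∀ x, f x * v x ≤ g1 x + ENNReal.ofReal (s / (2 * A)) * v x := by
    intro x
    by_cases hx : ENNReal.ofReal (s / (2 * A)) < f x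
    · have : g1 x = f x * v x := indicator_of_mem (s := {y | ENNReal.ofReal (s / (2 * A)) < f y}) hx _
      rw [this]; exact le_self_add
    · exact le_add_left (mul_le_mul_left (not_lt.1 hx) _)
  have hhalf : ENNReal.ofReal (s / (2 * A)) * ENNReal.ofReal A = ENNReal.ofReal (s / 2) := by
    rw [← ENNReal.ofReal_mul (by positivity)]
    congr 1
    field_simp
  have hss : ENNReal.ofReal s = ENNReal.ofReal (s / 2) + ENNReal.ofReal (s / 2) := by
    rw [← ENNReal.ofReal_add (by positivity) (by positivity)]; congr 1; ring
  have hsub : (volume.withDensity w)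
      {x | ENNReal.ofReal s < maximal (fun y => f y * v y) x / w x} ≤
      (volume.withDensity w) {x | ENNReal.ofReal (s / 2) * w x < maximal g1 x} := by
    apply measure_mono_ae
    filter_upwards [(withDensity_absolutelyContinuous volume w).ae_le hvw] with x hx hlt
    have h1 : ENNReal.ofReal s * w x < maximal (fun y => f y * v y) x :=
      ENNReal.mul_lt_of_lt_div hlt
    have h2 := h1.trans_le (maximal_mono_add _ g1 v hg1m _ hv hpt x)
    have h3 : ENNReal.ofReal (s / (2 * A)) * maximal v x ≤ ENNReal.ofReal (s / 2) * w x := by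
      rw [← hhalf, mul_assoc]; gcongr
    have h4 : ENNReal.ofReal (s / 2) * w x + ENNReal.ofReal (s / 2) * w x <
        maximal g1 x + ENNReal.ofReal (s / 2) * w x := by
      rw [← add_mul, ← hss]
      exact h2.trans_le (by gcongr)
    exact lt_of_add_lt_add_right h4
  have hwd : wDist volume w (fun x => maximal (fun y => f y * v y) x / w x) s ≤
      (volume.withDensity w) {x | ENNReal.ofReal (s / 2) * w x < maximal g1 x} :=
    (withDensity_apply_le _ _).trans hsub
  have hweak := weak11 w g1 (ENNReal.ofReal B) (ENNReal.ofReal (s / 2)) hw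
  rw [hg1, lintegral_indicator hmeas, ← hg1] at hweak
  calc _ ≤ ENNReal.ofReal s *
        (volume.withDensity w) {x | ENNReal.ofReal (s / 2) * w x < maximal g1 x} := by gcongr
    _ = 2 * (ENNReal.ofReal (s / 2) *
        (volume.withDensity w) {x | ENNReal.ofReal (s / 2) * w x < maximal g1 x}) := by
        rw [hss]; ring
    _ ≤ 2 * _ := mul_le_mul_right hweak 2
    _ = _ := by ring

lemma layer_pointwise (y : ℝ≥0∞) (a : ℝ) (ha : 0 < a) (hy : ENNReal.ofReal a < y) :
    y ≤ ∑' k : ℕ, ENNReal.ofReal (2 ^ (k + 1) * a) *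
      (if ENNReal.ofReal (2 ^ k * a) < y then 1 else 0) := by
  by_cases hty : y = ∞
  · subst hty
    simp only [ENNReal.ofReal_lt_top, if_true, mul_one]
    have : (∑' _ : ℕ, ENNReal.ofReal a) = ∞ :=
      ENNReal.tsum_const_eq_top_of_ne_zero (by simpa using ha)
    rw [← this]
    refine ENNReal.tsum_le_tsum fun k => ENNReal.ofReal_le_ofReal ?_
    have : (1 : ℝ) ≤ 2 ^ (k + 1) := one_le_pow₀ (by norm_num)
    nlinarith
  · lift y to ℝ≥0 using hty
    have hex : ∃ k : ℕ, (y : ℝ≥0∞) ≤ ENNReal.ofReal (2 ^ (k + 1) * a) := by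
      obtain ⟨k, hk⟩ := pow_unbounded_of_one_lt ((y : ℝ) / a) (one_lt_two)
      refine ⟨k, ?_⟩
      rw [ENNReal.le_ofReal_iff_toReal_le (by simp) (by positivity)]
      rw [div_lt_iff₀ ha] at hk
      simp only [ENNReal.coe_toReal]
      have : (0 : ℝ) < 2 ^ k := by positivity
      rw [pow_succ]
      nlinarith
    classical
    have hk := Nat.find_spec hex
    have hmin := fun m => Nat.find_min hex (m := m)
    set k := Nat.find hex
    have hlt : ENNReal.ofReal (2 ^ k * a) < y := by
      rcases hk0 : k with _ | m
      · simpa using hy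
      · exact not_le.1 (hmin m (by omega))
    refine le_trans ?_ (ENNReal.le_tsum k)
    rw [if_pos hlt, mul_one]
    exact hk

lemma layer {n : ℕ} (v f : (Fin n → ℝ) → ℝ≥0∞) (hv : Measurable v) (hf : Measurable f)
    (a : ℝ) (ha : 0 < a) :
    ∫⁻ y in {y | ENNReal.ofReal a < f y}, f y * v y ≤
      ∑' k : ℕ, ENNReal.ofReal (2 ^ (k + 1) * a) * wDist volume v f (2 ^ k * a) := by
  have hms : ∀ t : ℝ, MeasurableSet {y | ENNReal.ofReal t < f y} := fun t =>
    measurableSet_lt measurable_const hf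
  have hpt : ∀ y, ({y | ENNReal.ofReal a < f y}.indicator (fun y => f y * v y)) y ≤
      ∑' k : ℕ, ENNReal.ofReal (2 ^ (k + 1) * a) *
        ({y | ENNReal.ofReal (2 ^ k * a) < f y}.indicator v) y := by
    intro y
    by_cases hy : ENNReal.ofReal a < f y
    · rw [indicator_of_mem (s := {y | ENNReal.ofReal a < f y}) hy]
      refine (mul_le_mul_left (layer_pointwise (f y) a ha hy) (v y)).trans ?_
      rw [← ENNReal.tsum_mul_right]
      refine ENNReal.tsum_le_tsum fun k => ?_
      rw [mul_assoc]
      gcongr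
      by_cases h : ENNReal.ofReal (2 ^ k * a) < f y
      · rw [indicator_of_mem (s := {y | ENNReal.ofReal (2 ^ k * a) < f y}) h]
        rw [if_pos h, one_mul]
      · rw [if_neg h, zero_mul]
        exact zero_le
    · rw [indicator_of_notMem (s := {y | ENNReal.ofReal a < f y}) hy]
      exact zero_le
  rw [← lintegral_indicator (hms a)]
  refine (lintegral_mono hpt).trans ?_
  rw [lintegral_tsum (fun k => ((hv.indicator (hms _)).const_mul _).aemeasurable)]
  refine ENNReal.tsum_le_tsum fun k => ?_
  rw [lintegral_const_mul _ (hv.indicator (hms _)), lintegral_indicator (hms _)]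
  rfl

lemma rpow_finset_sum_le (θ : ℝ) (h0 : 0 < θ) (h1 : θ ≤ 1) (x : ℕ → ℝ≥0∞) (N : ℕ) :
    (∑ k ∈ Finset.range N, x k) ^ θ ≤ ∑ k ∈ Finset.range N, x k ^ θ := by
  induction N with
  | zero => simp [h0]
  | succ N ih =>
    rw [Finset.sum_range_succ, Finset.sum_range_succ]
    exact (ENNReal.rpow_add_le_add_rpow _ _ h0.le h1).trans (by gcongr)

lemma tsum_rpow_eq_iSup (θ : ℝ) (h0 : 0 < θ) (x : ℕ → ℝ≥0∞) :
    (∑' k, x k) ^ θ = ⨆ N, (∑ k ∈ Finset.range N, x k) ^ θ := by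
  rw [ENNReal.tsum_eq_iSup_nat]
  exact (ENNReal.orderIsoRpow θ h0).map_iSup _

lemma hardy_small {α : Type*} [MeasurableSpace α] (ν : Measure α) (θ : ℝ) (h0 : 0 < θ)
    (h1 : θ ≤ 1) (φ : ℕ → α → ℝ≥0∞) (hφ : ∀ k, Measurable (φ k)) (I ρ : ℝ≥0∞)
    (hI : ∀ k, ∫⁻ s, φ k s ^ θ ∂ν = I) :
    ∫⁻ s, (∑' k, ρ ^ k * φ k s) ^ θ ∂ν ≤ (1 - ρ ^ θ)⁻¹ * I := by
  have hpt : ∀ s, (∑' k, ρ ^ k * φ k s) ^ θ ≤ ∑' k, (ρ ^ θ) ^ k * φ k s ^ θ := by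
    intro s
    rw [tsum_rpow_eq_iSup θ h0]
    refine iSup_le fun N => (rpow_finset_sum_le θ h0 h1 _ N).trans ?_
    refine le_trans (le_of_eq ?_) (ENNReal.sum_le_tsum (Finset.range N))
    refine Finset.sum_congr rfl fun k _ => ?_
    rw [ENNReal.mul_rpow_of_nonneg _ _ h0.le, ← ENNReal.rpow_natCast, ← ENNReal.rpow_natCast,
      ← ENNReal.rpow_mul, ← ENNReal.rpow_mul, mul_comm θ]
  refine (lintegral_mono hpt).trans ?_
  rw [lintegral_tsum (fun k => (((hφ k).pow_const θ).const_mul _).aemeasurable)]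
  simp_rw [lintegral_const_mul _ ((hφ _).pow_const θ), hI]
  rw [ENNReal.tsum_mul_right, ENNReal.tsum_geometric]

lemma hardy_large {α : Type*} [MeasurableSpace α] (ν : Measure α) (θ : ℝ)
    (h1 : 1 ≤ θ) (φ : ℕ → α → ℝ≥0∞) (hφ : ∀ k, Measurable (φ k)) (I ρ : ℝ≥0∞)
    (hI : ∀ k, ∫⁻ s, φ k s ^ θ ∂ν = I) :
    ∫⁻ s, (∑' k, ρ ^ k * φ k s) ^ θ ∂ν ≤ ((1 - ρ)⁻¹) ^ θ * I := by
  have h0 : 0 < θ := by linarith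
  have hm : ∀ N, Measurable (fun s => ∑ k ∈ Finset.range N, ρ ^ k * φ k s) := fun N =>
    Finset.measurable_fun_sum _ fun k _ => (hφ k).const_mul _
  have hfin : ∀ N, (∫⁻ s, (∑ k ∈ Finset.range N, ρ ^ k * φ k s) ^ θ ∂ν) ^ (1 / θ) ≤
      (∑ k ∈ Finset.range N, ρ ^ k) * I ^ (1 / θ) := by
    intro N
    induction N with
    | zero => simp [h0]
    | succ N ih =>
      simp_rw [Finset.sum_range_succ, add_mul]
      refine (ENNReal.lintegral_Lp_add_le (hm N).aemeasurable
        ((hφ N).const_mul _).aemeasurable h1).trans ?_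
      gcongr
      apply le_of_eq
      simp_rw [ENNReal.mul_rpow_of_nonneg _ _ h0.le]
      rw [lintegral_const_mul _ ((hφ N).pow_const θ), hI,
        ENNReal.mul_rpow_of_nonneg _ _ (by positivity), ← ENNReal.rpow_mul,
        mul_one_div_cancel h0.ne', ENNReal.rpow_one]
  simp_rw [tsum_rpow_eq_iSup θ h0]
  rw [lintegral_iSup (fun N => (hm N).pow_const θ)]
  · refine iSup_le fun N => ?_
    have := ENNReal.rpow_le_rpow (hfin N) h0.le
    rw [← ENNReal.rpow_mul, one_div_mul_cancel h0.ne', ENNReal.rpow_one,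
      ENNReal.mul_rpow_of_nonneg _ _ h0.le, ← ENNReal.rpow_mul, one_div_mul_cancel h0.ne',
      ENNReal.rpow_one] at this
    refine this.trans ?_
    gcongr
    rw [← ENNReal.tsum_geometric]
    exact ENNReal.sum_le_tsum _
  · intro N M hNM s
    dsimp only
    gcongr

lemma geom_bound (p x : ℝ) (hp : 1 < p) (hx : 1 / p ≤ x) :
    (1 - ENNReal.ofReal (2 ^ (-x)))⁻¹ ≤ ENNReal.ofReal (2 * p) := by
  have h1 : (2 : ℝ) ^ (-x) ≤ 1 - 1 / (2 * p) := by
    calc (2 : ℝ) ^ (-x) ≤ 2 ^ (-(1 / p)) :=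
          Real.rpow_le_rpow_of_exponent_le (by norm_num) (by linarith)
      _ = (1 + (-1 / 2 : ℝ)) ^ (1 / p) := by
          rw [Real.rpow_neg (by norm_num), ← Real.inv_rpow (by norm_num)]; norm_num
      _ ≤ 1 + (1 / p) * (-1 / 2) :=
          rpow_one_add_le_one_add_mul_self (by norm_num) (by positivity)
            (by rw [div_le_one (by linarith)]; exact hp.le)
      _ = _ := by field_simp; ring
  have h2 : ENNReal.ofReal (2 * p) = (ENNReal.ofReal (1 / (2 * p)))⁻¹ := by
    rw [← ENNReal.ofReal_inv_of_pos (by positivity)]; simp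
  rw [h2, ENNReal.inv_le_inv, ← ENNReal.ofReal_one, ← ENNReal.ofReal_sub _ (by positivity)]
  exact ENNReal.ofReal_le_ofReal (by linarith)

lemma scale_inv (h : ℝ → ℝ≥0∞) (hh : Measurable h) (c : ℝ) (hc : 0 < c) :
    ∫⁻ s in Ioi (0 : ℝ), (ENNReal.ofReal s)⁻¹ * h (c * s) =
      ∫⁻ s in Ioi (0 : ℝ), (ENNReal.ofReal s)⁻¹ * h s := by
  have hF : Measurable ((Ioi (0 : ℝ)).indicator fun s => (ENNReal.ofReal s)⁻¹ * h s) :=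
    (ENNReal.measurable_ofReal.inv.mul hh).indicator measurableSet_Ioi
  rw [← lintegral_indicator measurableSet_Ioi, ← lintegral_indicator measurableSet_Ioi]
  conv_rhs => rw [← Real.smul_map_volume_mul_left hc.ne']
  rw [lintegral_smul_measure, lintegral_map hF (measurable_const_mul c), abs_of_pos hc,
    smul_eq_mul,
    ← lintegral_const_mul (f := fun a => (Ioi (0 : ℝ)).indicator
      (fun s => (ENNReal.ofReal s)⁻¹ * h s) (c * a)) _ (hF.comp (measurable_const_mul c))]
  refine lintegral_congr fun s => ?_
  by_cases hs : 0 < s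
  · have hcs : 0 < c * s := by positivity
    rw [indicator_of_mem (show s ∈ Ioi 0 from hs), indicator_of_mem (show c * s ∈ Ioi 0 from hcs),
      ← mul_assoc]
    congr 1
    rw [ENNReal.ofReal_mul hc.le, ENNReal.mul_inv (by simp) (by simp), ← mul_assoc,
      ENNReal.mul_inv_cancel (by simpa using hc) (by simp), one_mul]
  · have hcs : ¬ 0 < c * s := by
      intro h; exact hs ((mul_pos_iff_of_pos_left hc).1 h)
    rw [indicator_of_notMem (show s ∉ Ioi 0 from hs),
      indicator_of_notMem (show c * s ∉ Ioi 0 from hcs), mul_zero]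

lemma hardy_comb {α : Type*} [MeasurableSpace α] (ν : Measure α) (p P Q : ℝ) (hp : 1 < p)
    (hP : 1 < P) (hQ : 1 < Q) (hpP : 1 / p = (P - 1) / P)
    (φ : ℕ → α → ℝ≥0∞) (hφ : ∀ k, Measurable (φ k)) (I : ℝ≥0∞)
    (hI : ∀ k, ∫⁻ s, φ k s ^ (Q / P) ∂ν = I) :
    (∫⁻ s, (∑' k, ENNReal.ofReal (2 ^ (1 - P)) ^ k * φ k s) ^ (Q / P) ∂ν) ^ (1 / Q) ≤
      ENNReal.ofReal (2 * p) ^ (1 / min P Q) * I ^ (1 / Q) := by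
  have hP0 : 0 < P := by linarith
  have hQ0 : 0 < Q := by linarith
  have hp0 : 0 < p := by linarith
  rcases le_total Q P with h | h
  · have hθ : Q / P ≤ 1 := (div_le_one hP0).2 h
    refine (ENNReal.rpow_le_rpow (hardy_small ν (Q / P) (by positivity) hθ φ hφ I _ hI)
      (by positivity)).trans ?_
    rw [ENNReal.mul_rpow_of_nonneg _ _ (by positivity), min_eq_right h]
    gcongr
    have : ENNReal.ofReal (2 ^ (1 - P)) ^ (Q / P) =
        ENNReal.ofReal (2 ^ (-((P - 1) / P * Q))) := by
      rw [ENNReal.ofReal_rpow_of_pos (by positivity), ← Real.rpow_mul (by norm_num)]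
      congr 2
      ring
    rw [this]
    refine geom_bound p _ hp ?_
    rw [← hpP]
    have : 0 < 1 / p := by positivity
    nlinarith
  · have hθ : 1 ≤ Q / P := (one_le_div hP0).2 h
    refine (ENNReal.rpow_le_rpow (hardy_large ν (Q / P) hθ φ hφ I _ hI)
      (by positivity)).trans ?_
    rw [ENNReal.mul_rpow_of_nonneg _ _ (by positivity), min_eq_left h, ← ENNReal.rpow_mul]
    have : Q / P * (1 / Q) = 1 / P := by field_simp
    rw [this]
    gcongr
    rw [show (1 - P) = -(P - 1) by ring]
    refine geom_bound p _ hp ?_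
    rw [hpP, div_le_iff₀ hP0]
    nlinarith

lemma wDist_antitone {α : Type*} [MeasurableSpace α] (μ : Measure α) (w f : α → ℝ≥0∞) :
    Antitone (wDist μ w f) := by
  intro s t hst
  unfold wDist
  exact lintegral_mono_set fun x hx => lt_of_le_of_lt (ENNReal.ofReal_le_ofReal hst) hx

lemma const_bound (n : ℕ) (p P m A B : ℝ) (hp : 1 < p) (hP : 1 < P) (hm : 1 < m) (hA : 0 < A)
    (hB : 0 < B) :
    (2 * (2 * 6 ^ n * B) * (2 * A) ^ (P - 1)) ^ (1 / P) * (2 * p) ^ (1 / m) ≤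
      (16 * 6 ^ n) * p ^ (1 / m) * Real.log (Real.exp 1 + A) ^ (1 / m) * (1 + A) * B ^ (1 / P) := by
  have hP0 : 0 < P := by linarith
  have hm0 : 0 < m := by linarith
  have hp0 : 0 < p := by linarith
  have hlog : 1 ≤ Real.log (Real.exp 1 + A) ^ (1 / m) := by
    apply Real.one_le_rpow _ (by positivity)
    rw [Real.le_log_iff_exp_le (by positivity)]
    linarith
  have hP1 : 1 / P ≤ 1 := (div_le_one hP0).2 hP.le
  have hm1 : 1 / m ≤ 1 := (div_le_one hm0).2 hm.le
  have h6 : (1 : ℝ) ≤ 6 ^ n := one_le_pow₀ (by norm_num)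
  have e1 : (2 * (2 * 6 ^ n * B) * (2 * A) ^ (P - 1)) ^ (1 / P) =
      (4 * 6 ^ n) ^ (1 / P) * B ^ (1 / P) * (2 * A) ^ ((P - 1) / P) := by
    rw [show 2 * (2 * 6 ^ n * B) = 4 * 6 ^ n * B by ring,
      Real.mul_rpow (by positivity) (by positivity), Real.mul_rpow (by positivity) (by positivity),
      ← Real.rpow_mul (by positivity), mul_one_div]
  have e2 : (4 * 6 ^ n : ℝ) ^ (1 / P) ≤ 4 * 6 ^ n :=
    (Real.rpow_le_rpow_of_exponent_le (by linarith) hP1).trans (by rw [Real.rpow_one])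
  have e3 : (2 * A) ^ ((P - 1) / P) ≤ 2 * (1 + A) := by
    calc (2 * A) ^ ((P - 1) / P) ≤ (2 * (1 + A)) ^ ((P - 1) / P) :=
          Real.rpow_le_rpow (by positivity) (by linarith)
            (div_nonneg (by linarith) hP0.le)
      _ ≤ (2 * (1 + A)) ^ (1 : ℝ) := Real.rpow_le_rpow_of_exponent_le (by linarith)
            ((div_le_one hP0).2 (by linarith))
      _ = _ := Real.rpow_one _
  have e4 : (2 * p) ^ (1 / m) ≤ 2 * p ^ (1 / m) := by
    rw [Real.mul_rpow (by norm_num) hp0.le]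
    gcongr
    exact (Real.rpow_le_rpow_of_exponent_le (by norm_num) hm1).trans (by rw [Real.rpow_one])
  rw [e1]
  calc _ ≤ (4 * 6 ^ n) * B ^ (1 / P) * (2 * (1 + A)) * (2 * p ^ (1 / m)) := by gcongr
    _ = (16 * 6 ^ n) * p ^ (1 / m) * 1 * (1 + A) * B ^ (1 / P) := by ring
    _ ≤ _ := by gcongr

/-- The main inequality for the distribution functions `G` of `Tf` and `D` of `f`. -/
lemma dist_to_phi (P A : ℝ) (hA : 0 < A) (G K : ℝ≥0∞) (D : ℝ → ℝ≥0∞)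
    (s : ℝ) (hs : 0 < s)
    (h : ENNReal.ofReal s * G ≤ K * ∑' k : ℕ, ENNReal.ofReal (2 ^ (k + 1) * (s / (2 * A))) *
      D (2 ^ k * (s / (2 * A)))) :
    ENNReal.ofReal s ^ P * G ≤ (2 * K * ENNReal.ofReal ((2 * A) ^ (P - 1))) *
      ∑' k : ℕ, ENNReal.ofReal (2 ^ (1 - P)) ^ k *
        (ENNReal.ofReal (2 ^ k / (2 * A) * s) ^ P * D (2 ^ k / (2 * A) * s)) := by
  have e : ENNReal.ofReal s ^ P * G = ENNReal.ofReal (s ^ (P - 1)) * (ENNReal.ofReal s * G) := by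
    rw [ENNReal.ofReal_rpow_of_pos hs, ← mul_assoc, ← ENNReal.ofReal_mul (by positivity)]
    congr 2
    rw [Real.rpow_sub_one hs.ne']
    field_simp
  rw [e]
  refine (mul_le_mul_right h _).trans (le_of_eq ?_)
  rw [← ENNReal.tsum_mul_left, ← ENNReal.tsum_mul_left, ← ENNReal.tsum_mul_left]
  refine tsum_congr fun k => ?_
  have e2 : (2 : ℝ) ^ k * (s / (2 * A)) = 2 ^ k / (2 * A) * s := by ring
  rw [e2]
  have e3 : (2 : ℝ≥0∞) = ENNReal.ofReal 2 := by simp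
  have key : s ^ (P - 1) * (2 ^ (k + 1) * (s / (2 * A))) =
      2 * (2 * A) ^ (P - 1) * ((2 ^ (1 - P)) ^ k * (2 ^ k / (2 * A) * s) ^ P) := by
    have h2k : (0 : ℝ) < 2 ^ k := by positivity
    have hx : ((2 : ℝ) ^ (1 - P)) ^ k = 2 ^ k / (2 ^ k) ^ P := by
      rw [← Real.rpow_natCast, ← Real.rpow_mul (by norm_num), ← Real.rpow_natCast,
        ← Real.rpow_mul (by norm_num), ← Real.rpow_sub (by norm_num)]
      congr 1
      ring
    rw [hx, Real.mul_rpow (by positivity) hs.le, Real.div_rpow (by positivity) (by positivity),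
      Real.rpow_sub_one hs.ne', Real.rpow_sub_one (by positivity)]
    have : (0 : ℝ) < (2 ^ k) ^ P := by positivity
    have : (0 : ℝ) < (2 * A) ^ P := by positivity
    field_simp
    ring
  have key2 : ENNReal.ofReal (s ^ (P - 1)) * ENNReal.ofReal (2 ^ (k + 1) * (s / (2 * A))) =
      ENNReal.ofReal 2 * ENNReal.ofReal ((2 * A) ^ (P - 1)) *
        (ENNReal.ofReal (2 ^ (1 - P)) ^ k * ENNReal.ofReal (2 ^ k / (2 * A) * s) ^ P) := by
    rw [ENNReal.ofReal_rpow_of_pos (by positivity), ← ENNReal.ofReal_pow (by positivity),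
      ← ENNReal.ofReal_mul (by positivity), ← ENNReal.ofReal_mul (by positivity),
      ← ENNReal.ofReal_mul (by positivity), ← ENNReal.ofReal_mul (by positivity), key]
  calc _ = (ENNReal.ofReal (s ^ (P - 1)) * ENNReal.ofReal (2 ^ (k + 1) * (s / (2 * A)))) *
        (K * D (2 ^ k / (2 * A) * s)) := by ring
    _ = _ := by rw [key2, ← e3]; ring

lemma conj_facts (p : ℝ) (hp : 1 < p) :
    1 < conjExp p ∧ 1 / p = (conjExp p - 1) / conjExp p := by
  unfold conjExp
  have : 0 < p - 1 := by linarith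
  constructor
  · rw [one_lt_div this]; linarith
  · field_simp; ring

/-- Dual estimate: for `(v,w) ∈ A_1` and `w ∈ A_1`, the operator `Tf = M(fv)/w` is bounded
on weighted Lorentz spaces with the stated quantitative bound. -/
theorem dual_maximal_lorentz (n : ℕ) :
    ∃ C : ℝ, 0 < C ∧
      ∀ p q : ℝ, 1 < p → 1 < q →
        ∀ v w : (Fin n → ℝ) → ℝ≥0∞, Measurable v → Measurable w →
          ∀ A B : ℝ, 0 < A → 0 < B →
            (∀ᵐ x ∂(volume : Measure (Fin n → ℝ)), maximal v x ≤ ENNReal.ofReal A * w x) →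
            (∀ᵐ x ∂(volume : Measure (Fin n → ℝ)), maximal w x ≤ ENNReal.ofReal B * w x) →
            ∀ f : (Fin n → ℝ) → ℝ≥0∞, Measurable f →
              lorentzNorm volume w (conjExp p) (ENNReal.ofReal (conjExp q))
                  (fun x => maximal (fun y => f y * v y) x / w x) ≤
                ENNReal.ofReal (C * p ^ (1 / min (conjExp p) (conjExp q)) *
                    Real.log (Real.exp 1 + A) ^ (1 / min (conjExp p) (conjExp q)) *
                    (1 + A) * B ^ (1 / conjExp p)) *
                  lorentzNorm volume v (conjExp p) (ENNReal.ofReal (conjExp q)) f := by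
  refine ⟨16 * 6 ^ n, by positivity, ?_⟩
  intro p q hp hq v w hv hw A B hA hB hvw hww f hf
  obtain ⟨hP, hpP⟩ := conj_facts p hp
  obtain ⟨hQ, -⟩ := conj_facts q hq
  generalize conjExp p = P at *
  generalize conjExp q = Q at *
  have hP0 : 0 < P := by linarith
  have hQ0 : 0 < Q := by linarith
  have hp0 : 0 < p := by linarith
  have hm : 1 < min P Q := lt_min hP hQ
  have hm0 : 0 < min P Q := by linarith
  unfold lorentzNorm
  rw [if_neg ENNReal.ofReal_ne_top, if_neg ENNReal.ofReal_ne_top, ENNReal.toReal_ofReal hQ0.le]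
  set G := wDist volume w (fun x => maximal (fun y => f y * v y) x / w x) with hG
  set D := wDist volume v f with hD
  have hDm : Measurable D := (wDist_antitone volume v f).measurable
  set K : ℝ := 2 * (2 * 6 ^ n * B) * (2 * A) ^ (P - 1) with hK
  have hK0 : 0 < K := by positivity
  set φ : ℝ → ℝ≥0∞ := fun t => ENNReal.ofReal t ^ P * D t with hφ
  have hφm : Measurable φ := (ENNReal.measurable_ofReal.pow_const P).mul hDm
  set ν : Measure ℝ := (volume.restrict (Ioi (0 : ℝ))).withDensity
    (fun s => (ENNReal.ofReal s)⁻¹) with hν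
  have hνi : ∀ h : ℝ → ℝ≥0∞, Measurable h →
      ∫⁻ s, h s ∂ν = ∫⁻ s in Ioi (0 : ℝ), (ENNReal.ofReal s)⁻¹ * h s := by
    intro h hh
    have hm : Measurable fun s : ℝ => (ENNReal.ofReal s)⁻¹ := ENNReal.measurable_ofReal.inv
    rw [hν, lintegral_withDensity_eq_lintegral_mul _ hm hh]
    rfl
  have hpow : ∀ (s : ℝ) (X : ℝ≥0∞), ENNReal.ofReal s ^ Q * X ^ (Q / P) =
      (ENNReal.ofReal s ^ P * X) ^ (Q / P) := by
    intro s X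
    rw [ENNReal.mul_rpow_of_nonneg _ _ (by positivity), ← ENNReal.rpow_mul]
    congr 2
    field_simp
  have hpt : ∀ s : ℝ, 0 < s → ENNReal.ofReal s ^ P * G s ≤ ENNReal.ofReal K *
      ∑' k : ℕ, ENNReal.ofReal (2 ^ (1 - P)) ^ k * φ (2 ^ k / (2 * A) * s) := by
    intro s hs
    have h1 := dist_bound v w f hv hf A B hA hvw hww s hs
    have h2 := layer v f hv hf (s / (2 * A)) (by positivity)
    have h3 := dist_to_phi P A hA (G s) (2 * 6 ^ n * ENNReal.ofReal B) D s hs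
      (h1.trans (mul_le_mul_right h2 _))
    refine h3.trans (le_of_eq ?_)
    congr 1
    rw [hK, ENNReal.ofReal_mul (by positivity), ENNReal.ofReal_mul (by positivity),
      ENNReal.ofReal_mul (by positivity), ENNReal.ofReal_mul (by positivity),
      ENNReal.ofReal_pow (by norm_num)]
    simp
  have hI : ∀ k : ℕ, ∫⁻ s, φ (2 ^ k / (2 * A) * s) ^ (Q / P) ∂ν =
      ∫⁻ s in Ioi (0 : ℝ), (ENNReal.ofReal s)⁻¹ * φ s ^ (Q / P) := by
    intro k
    refine (hνi (fun s => φ (2 ^ k / (2 * A) * s) ^ (Q / P))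
      ((hφm.comp (measurable_const_mul _)).pow_const _)).trans ?_
    exact scale_inv (fun s => φ s ^ (Q / P)) (hφm.pow_const _) _ (by positivity)
  have hH := hardy_comb ν p P Q hp hP hQ hpP (fun k s => φ (2 ^ k / (2 * A) * s))
    (fun k => hφm.comp (measurable_const_mul _)) _ hI
  have hR : ∫⁻ s in Ioi (0 : ℝ), ENNReal.ofReal s ^ Q * D s ^ (Q / P) / ENNReal.ofReal s =
      ∫⁻ s in Ioi (0 : ℝ), (ENNReal.ofReal s)⁻¹ * φ s ^ (Q / P) := by
    refine lintegral_congr fun s => ?_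
    rw [hpow, div_eq_mul_inv, mul_comm]
  have hsm : Measurable fun s => ∑' k : ℕ, ENNReal.ofReal (2 ^ (1 - P)) ^ k *
      φ (2 ^ k / (2 * A) * s) :=
    Measurable.tsum fun k => (hφm.comp (measurable_const_mul _)).const_mul _
  have hL : ∫⁻ s in Ioi (0 : ℝ), ENNReal.ofReal s ^ Q * G s ^ (Q / P) / ENNReal.ofReal s ≤
      ENNReal.ofReal K ^ (Q / P) * ∫⁻ s, (∑' k : ℕ, ENNReal.ofReal (2 ^ (1 - P)) ^ k *
        φ (2 ^ k / (2 * A) * s)) ^ (Q / P) ∂ν := by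
    rw [← lintegral_const_mul _ (hsm.pow_const _), hνi _ ((hsm.pow_const _).const_mul _)]
    refine setLIntegral_mono' measurableSet_Ioi fun s hs => ?_
    rw [hpow, div_eq_mul_inv, mul_comm, ← ENNReal.mul_rpow_of_nonneg _ _ (by positivity)]
    exact mul_le_mul_right (ENNReal.rpow_le_rpow (hpt s hs) (by positivity)) _
  rw [hR]
  set I := ∫⁻ s in Ioi (0 : ℝ), (ENNReal.ofReal s)⁻¹ * φ s ^ (Q / P) with hIdef
  have hQi : 0 ≤ 1 / Q := by positivity
  calc _ ≤ (ENNReal.ofReal P * (ENNReal.ofReal K ^ (Q / P) *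
        ∫⁻ s, (∑' k : ℕ, ENNReal.ofReal (2 ^ (1 - P)) ^ k *
        φ (2 ^ k / (2 * A) * s)) ^ (Q / P) ∂ν)) ^ (1 / Q) := by gcongr
    _ = ENNReal.ofReal P ^ (1 / Q) * (ENNReal.ofReal K ^ (1 / P) *
        (∫⁻ s, (∑' k : ℕ, ENNReal.ofReal (2 ^ (1 - P)) ^ k *
        φ (2 ^ k / (2 * A) * s)) ^ (Q / P) ∂ν) ^ (1 / Q)) := by
        rw [ENNReal.mul_rpow_of_nonneg _ _ hQi, ENNReal.mul_rpow_of_nonneg _ _ hQi,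
          ← ENNReal.rpow_mul, show Q / P * (1 / Q) = 1 / P by field_simp]
    _ ≤ ENNReal.ofReal P ^ (1 / Q) * (ENNReal.ofReal K ^ (1 / P) *
        (ENNReal.ofReal (2 * p) ^ (1 / min P Q) * I ^ (1 / Q))) := by gcongr
    _ = (ENNReal.ofReal K ^ (1 / P) * ENNReal.ofReal (2 * p) ^ (1 / min P Q)) *
        (ENNReal.ofReal P * I) ^ (1 / Q) := by
        rw [ENNReal.mul_rpow_of_nonneg _ _ hQi]; ring
    _ ≤ _ := by
        gcongr
        rw [ENNReal.ofReal_rpow_of_pos hK0, ENNReal.ofReal_rpow_of_pos (by positivity),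
          ← ENNReal.ofReal_mul (by positivity)]
        exact ENNReal.ofReal_le_ofReal (const_bound n p P (min P Q) A B hp hP hm hA hB)
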